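/- Let A be a row-standard μ-tableau of type λ (μ ⊢ n, λ ⊨ n), let l be maximal such that μ_l > 0, write μ̃ = (μ_1,…,μ_{l−1}), let Ã be the μ̃-tableau obtained by deleting the last row of A, and let λ̃ be its type. Then there exists h ∈ H_n, depending only on μ, λ and λ̃ (and not otherwise on A), such that x_μ φ_A = h · (x_{μ̃} φ_{Ã}), where x_{μ̃} φ_{Ã} is computed in H_{n−μ_l} and regarded as an element of H_n via the standard embedding Γ_0 : H_{n−μ_l} → H_n, T_i ↦ T_i. -/

import Mathlib

open scoped Classical

noncomputable section

namespace FayersSemistd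

/-- The value at `q` of the Gaussian (quantum) binomial coefficient polynomial
`[a choose b]`, defined via the `q`-Pascal recurrence. -/
def qBinom {F : Type*} [Field F] (q : F) : ℕ → ℕ → F
  | _, 0 => 1
  | 0, _+1 => 0
  | a+1, b+1 => qBinom q a b + q ^ (b+1) * qBinom q a (b+1)

/-- `∏_i [A_i + B_i choose A_i]_q`, where `A_i`, `B_i` are multiplicities in the
multisets `A` and `B`. -/
def qBinomProd {F : Type*} [Field F] (q : F) (A B : Multiset ℕ) : F :=
  ∏ i ∈ (A + B).toFinset, qBinom q ((A + B).count i) (A.count i)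

/-- `∑_{i<j} A_j * B_i` : the number of pairs `(x,y)` with `x ∈ A`, `y ∈ B`, `y < x`,
counted with multiplicity. -/
def invPairs (A B : Multiset ℕ) : ℕ :=
  ((A.product B).filter (fun p => p.2 < p.1)).card

/-- The Coxeter length of a permutation of `{0,…,n-1}`: its number of inversions. -/
def permLength {n : ℕ} (w : Equiv.Perm (Fin n)) : ℕ :=
  (Finset.univ.filter (fun p : Fin n × Fin n => p.1 < p.2 ∧ w p.2 < w p.1)).card

/-- `λ_0 + ⋯ + λ_{r-1}`. -/
def cumSum (lam : ℕ → ℕ) (r : ℕ) : ℕ := ∑ i ∈ Finset.range r, lam i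

/-- The (0-indexed) row of the diagram of `λ` containing the (0-indexed) position `p`,
when positions are listed row by row. -/
def rowOf (lam : ℕ → ℕ) (p : ℕ) : ℕ := sInf {r | p < cumSum lam (r+1)}

/-- `λ` is a composition of `n`: finitely many nonzero parts, summing to `n`. -/
def IsComposition (n : ℕ) (lam : ℕ → ℕ) : Prop :=
  ∃ N, (∀ r, N ≤ r → lam r = 0) ∧ cumSum lam N = n

/-- `μ` is a partition of `n`. -/
def IsPartition (n : ℕ) (mu : ℕ → ℕ) : Prop := IsComposition n mu ∧ Antitone mu

/-- The conjugate partition (0-indexed): `conjP μ i = #{r | μ r > i}`. -/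
def conjP (mu : ℕ → ℕ) (i : ℕ) : ℕ := sInf {r | mu r ≤ i}

/-- The standard Young subgroup `W_λ` of `S_n` (as a set): the permutations preserving
each consecutive block of sizes `λ_0, λ_1, …`. -/
def youngW {n : ℕ} (lam : ℕ → ℕ) : Set (Equiv.Perm (Fin n)) :=
  {w | ∀ p : Fin n, rowOf lam ((w p : Fin n) : ℕ) = rowOf lam (p : ℕ)}

/-- The adjacent transposition `(i, i+1)` (0-indexed) in `S_n`. -/
def adjT {n : ℕ} (i : ℕ) (h : i + 1 < n) : Equiv.Perm (Fin n) :=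
  Equiv.swap ⟨i, Nat.lt_of_succ_lt h⟩ ⟨i+1, h⟩

/-- `T : S_n → H` is the standard basis of an Iwahori–Hecke algebra of `S_n` over `F`
with parameter `q`.  Permutations act on the right, so the product `w·s` of the paper
is `s * w` in Mathlib's convention; the multiplication rule
`T_w T_s = T_{ws}` (length increasing) resp. `T_w T_s = q T_{ws} + (q-1) T_w`
(length decreasing) determines the algebra structure on the basis. -/
structure IsHeckeBasis {F : Type*} [Field F] {H : Type*} [Ring H] [Algebra F H] {n : ℕ}
    (q : F) (T : Equiv.Perm (Fin n) → H) : Prop where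
  li : LinearIndependent F T
  total : Submodule.span F (Set.range T) = ⊤
  one : T 1 = 1
  mul_adj_asc : ∀ (w : Equiv.Perm (Fin n)) (i : ℕ) (h : i + 1 < n),
    permLength w < permLength (adjT i h * w) →
    T w * T (adjT i h) = T (adjT i h * w)
  mul_adj_desc : ∀ (w : Equiv.Perm (Fin n)) (i : ℕ) (h : i + 1 < n),
    permLength (adjT i h * w) < permLength w →
    T w * T (adjT i h) = q • T (adjT i h * w) + (q - 1) • T w

variable {F : Type*} [Field F] {H : Type*} [Ring H] [Algebra F H] {n : ℕ}

/-- `x_λ = ∑_{w ∈ W_λ} T_w`. -/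
def xElt (T : Equiv.Perm (Fin n) → H) (lam : ℕ → ℕ) : H :=
  ∑ w ∈ Finset.univ.filter (· ∈ youngW lam), T w

/-- `y_λ = ∑_{w ∈ W_λ} (-q)^{-l(w)} T_w`. -/
def yElt (q : F) (T : Equiv.Perm (Fin n) → H) (lam : ℕ → ℕ) : H :=
  ∑ w ∈ Finset.univ.filter (· ∈ youngW lam), ((-q)⁻¹) ^ permLength w • T w

/-- The double coset `W_λ d W_μ` (paper convention: maps act on the right, so the
paper product `u·d·v` is `v * d * u` in Mathlib's convention). -/
def doubleCoset {n : ℕ} (lam mu : ℕ → ℕ) (d : Equiv.Perm (Fin n)) :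
    Set (Equiv.Perm (Fin n)) :=
  {w | ∃ u ∈ youngW (n := n) lam, ∃ v ∈ youngW (n := n) mu, w = v * d * u}

/-- `∑_{w ∈ W_λ 1_A W_μ} T_w`, the image `x_μ φ_A` of `x_μ` under the tableau
homomorphism `φ_A : M^μ → M^λ`, where `d = 1_A`. -/
def XPhi (T : Equiv.Perm (Fin n) → H) (lam mu : ℕ → ℕ) (d : Equiv.Perm (Fin n)) : H :=
  ∑ w ∈ Finset.univ.filter (· ∈ doubleCoset lam mu d), T w

/-- A row-standard tableau is recorded by the multisets of entries of its rows; it has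
shape `μ` when row `r` has `μ_r` entries. -/
def RowsOfShape (mu : ℕ → ℕ) (A : ℕ → Multiset ℕ) : Prop := ∀ r, (A r).card = mu r

/-- The tableau with rows `A 0, A 1, …` has type `λ` when the entry `v` occurs `λ_v`
times in total (entries and types are 0-indexed). -/
def HasType (A : ℕ → Multiset ℕ) (lam : ℕ → ℕ) : Prop :=
  ∀ v, (∑ᶠ r, (A r).count v) = lam v

/-- The entry in row `r`, column `c` (0-indexed) of the row-standard tableau with row
multisets `A`. -/
def entryAt (A : ℕ → Multiset ℕ) (r c : ℕ) : ℕ := ((A r).sort (· ≤ ·)).getD c 0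

/-- `d = 1_A` for the row-standard `μ`-tableau `A` of type `λ`: the tableau `t^λ d`
(whose entry at position `p` is `d p`) is row-standard (first clause), and the entry
`d p` lies in row `r` of `t^λ d` exactly when the position occupied by `d p` in `t^μ`
is occupied by `r` in `A` (second clause). -/
def Is1A {n : ℕ} (mu lam : ℕ → ℕ) (A : ℕ → Multiset ℕ) (d : Equiv.Perm (Fin n)) : Prop :=
  (∀ p p' : Fin n, rowOf lam (p : ℕ) = rowOf lam (p' : ℕ) → p < p' → d p < d p') ∧
  (∀ p : Fin n,
    entryAt A (rowOf mu ((d p : Fin n) : ℕ))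
      (((d p : Fin n) : ℕ) - cumSum mu (rowOf mu ((d p : Fin n) : ℕ)))
      = rowOf lam (p : ℕ))

/-- A row-standard tableau is semistandard if its columns are strictly increasing. -/
def Semistandard (mu : ℕ → ℕ) (A : ℕ → Multiset ℕ) : Prop :=
  ∀ r c, c < mu (r+1) → entryAt A r c < entryAt A (r+1) c

/-- The (0-indexed) column of the position `p` in the diagram of `μ`. -/
def colIdx (mu : ℕ → ℕ) (p : ℕ) : ℕ := p - cumSum mu (rowOf mu p)

/-- `w = w_μ`, i.e. `t^μ w = t_μ`: the image of position `p` is the number of positions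
coming strictly before `p` in the column-reading order of the diagram of `μ`. -/
def IsWmu {n : ℕ} (mu : ℕ → ℕ) (w : Equiv.Perm (Fin n)) : Prop :=
  ∀ p : Fin n, ((w p : Fin n) : ℕ) = (Finset.univ.filter (fun p' : Fin n =>
    colIdx mu (p' : ℕ) < colIdx mu (p : ℕ) ∨
      (colIdx mu (p' : ℕ) = colIdx mu (p : ℕ) ∧ rowOf mu (p' : ℕ) < rowOf mu (p : ℕ)))).card

def comp1 (a : ℕ) : ℕ → ℕ := fun r => if r = 0 then a else 0
def comp2 (a b : ℕ) : ℕ → ℕ := fun r => if r = 0 then a else if r = 1 then b else 0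
def comp3 (a b c : ℕ) : ℕ → ℕ :=
  fun r => if r = 0 then a else if r = 1 then b else if r = 2 then c else 0
def comp4 (a b c d : ℕ) : ℕ → ℕ :=
  fun r => if r = 0 then a else if r = 1 then b else if r = 2 then c else if r = 3 then d else 0
def rows1 (a : Multiset ℕ) : ℕ → Multiset ℕ := fun r => if r = 0 then a else 0
def rows2 (a b : Multiset ℕ) : ℕ → Multiset ℕ :=
  fun r => if r = 0 then a else if r = 1 then b else 0
def rows3 (a b c : Multiset ℕ) : ℕ → Multiset ℕ :=
  fun r => if r = 0 then a else if r = 1 then b else if r = 2 then c else 0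
def rows4 (a b c d : Multiset ℕ) : ℕ → Multiset ℕ :=
  fun r => if r = 0 then a else if r = 1 then b else if r = 2 then c else if r = 3 then d else 0

end FayersSemistd
namespace FayersSemistd

section Permutations

variable {m n : ℕ}

lemma permLength_lt_adjT_mul (w : Equiv.Perm (Fin n)) (i : ℕ) (h : i + 1 < n)
    (hw : w⁻¹ ⟨i, Nat.lt_of_succ_lt h⟩ < w⁻¹ ⟨i + 1, h⟩) :
    permLength w < permLength (adjT i h * w) := by
  unfold permLength
  apply Finset.card_lt_card
  rw [Finset.ssubset_iff_of_subset]
  · refine ⟨(w⁻¹ ⟨i, Nat.lt_of_succ_lt h⟩, w⁻¹ ⟨i + 1, h⟩), ?_, ?_⟩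
    · refine Finset.mem_filter.2 ⟨Finset.mem_univ _, hw, ?_⟩
      simp [adjT]
    · simp
  · rintro ⟨p, p'⟩ hp
    simp only [Finset.mem_filter, Finset.mem_univ, true_and] at hp ⊢
    refine ⟨hp.1, ?_⟩
    have hne : ¬ (w p' = ⟨i, Nat.lt_of_succ_lt h⟩ ∧ w p = ⟨i + 1, h⟩) := by
      rintro ⟨h1, h2⟩
      rw [← h1, ← h2] at hw
      exact lt_asymm hp.1 (by simpa using hw)
    have hlt := hp.2
    simp only [adjT, Equiv.Perm.mul_apply, Equiv.swap_apply_def]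
    simp only [Fin.ext_iff, Fin.lt_def] at *
    split_ifs <;> (try dsimp only) <;> omega

lemma perm_eq_one_of_strictMono (w : Equiv.Perm (Fin n)) (hw : StrictMono w) : w = 1 := by
  have := Tuple.unique_monotone (f := (id : Fin n → Fin n)) (σ := w) (τ := 1)
    hw.monotone monotone_id
  exact Equiv.ext fun x => congrFun this x

lemma exists_inv_succ_lt_of_ne_one (w : Equiv.Perm (Fin n)) (hw : w ≠ 1) :
    ∃ (i : ℕ) (h : i + 1 < n), w⁻¹ ⟨i + 1, h⟩ < w⁻¹ ⟨i, Nat.lt_of_succ_lt h⟩ := by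
  by_contra! hcon
  apply hw
  rw [← inv_eq_one]
  apply perm_eq_one_of_strictMono
  rcases n with _ | n
  · exact fun x => x.elim0
  · rw [Fin.strictMono_iff_lt_succ]
    intro i
    refine lt_of_le_of_ne (hcon i (by omega)) fun he => ?_
    exact absurd ((w⁻¹).injective he) (by simp [Fin.ext_iff])

/-- The standard embedding of `S_m` into `S_n`, for `m ≤ n`. -/
def embedPerm (hmn : m ≤ n) : Equiv.Perm (Fin m) →* Equiv.Perm (Fin n) :=
  Equiv.Perm.extendDomainHom (p := (· ∈ {i : Fin n | (i : ℕ) < m}))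
    (Fin.castLEOrderIso hmn).toEquiv

lemma embedPerm_castLE (hmn : m ≤ n) (w : Equiv.Perm (Fin m)) (k : Fin m) :
    embedPerm hmn w (Fin.castLE hmn k) = Fin.castLE hmn (w k) :=
  Equiv.Perm.extendDomain_apply_image w (Fin.castLEOrderIso hmn).toEquiv k

lemma embedPerm_of_le (hmn : m ≤ n) (w : Equiv.Perm (Fin m)) (k : Fin n) (hk : m ≤ k) :
    embedPerm hmn w k = k :=
  Equiv.Perm.extendDomain_apply_not_subtype w (Fin.castLEOrderIso hmn).toEquiv
    (by simpa using hk)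

lemma forall_fin_of_castLE (hmn : m ≤ n) {P : Fin n → Prop}
    (h₁ : ∀ k : Fin m, P (Fin.castLE hmn k)) (h₂ : ∀ k : Fin n, m ≤ k → P k) (k : Fin n) :
    P k := by
  by_cases hk : (k : ℕ) < m
  · exact h₁ ⟨k, hk⟩
  · exact h₂ k (not_lt.1 hk)

lemma embedPerm_adjT (hmn : m ≤ n) (i : ℕ) (h : i + 1 < m) :
    embedPerm hmn (adjT i h) = adjT i (h.trans_le hmn) := by
  refine Equiv.ext (forall_fin_of_castLE hmn (fun k => ?_) fun k hk => ?_)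
  · rw [embedPerm_castLE]
    simp only [adjT, Equiv.swap_apply_def, Fin.ext_iff, Fin.val_castLE]
    split_ifs <;> rfl
  · rw [embedPerm_of_le hmn _ _ hk, adjT, Equiv.swap_apply_of_ne_of_ne] <;>
      simp only [ne_eq, Fin.ext_iff] <;> omega

lemma exists_perm_comp_eq {α γ : Type*} [Fintype α] (f g : α → γ)
    (h : ∀ c, Nat.card {x // f x = c} = Nat.card {x // g x = c}) :
    ∃ e : Equiv.Perm α, ∀ x, f (e x) = g x := by
  have E c := Classical.choice (Finite.card_eq.1 (h c))
  refine ⟨(Equiv.sigmaFiberEquiv g).symm.trans ((Equiv.sigmaCongrRight fun c =>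
    (E c).symm).trans (Equiv.sigmaFiberEquiv f)), fun x => ?_⟩
  exact ((E (g x)).symm ⟨x, rfl⟩).2

/-- If `G` is a rearrangement of `F` and agrees with it on a set, then it is a rearrangement of
`F` by a permutation fixing that set pointwise. -/
lemma exists_perm_fixing {α γ : Type*} [Fintype α] (S : α → Prop) (F G : α → γ)
    (σ : Equiv.Perm α) (hσ : ∀ k, F (σ k) = G k) (hS : ∀ k, S k → F k = G k) :
    ∃ ρ : Equiv.Perm α, (∀ k, S k → ρ k = k) ∧ ∀ k, F (ρ k) = G k := by
  obtain ⟨ρ, hρ⟩ := exists_perm_comp_eq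
    (fun k => if S k then (Sum.inl k : α ⊕ γ) else Sum.inr (F k))
    (fun k => if S k then (Sum.inl k : α ⊕ γ) else Sum.inr (G k)) (by
      rintro (c | c)
      · refine Nat.card_congr (Equiv.subtypeEquivRight fun x => ?_)
        split_ifs <;> simp
      · have hFG : (Finset.univ.filter fun x => F x = c).card
            = (Finset.univ.filter fun x => G x = c).card := by
          refine (Finset.card_equiv σ fun x => ?_).symm
          simp [hσ]
        have hin : (Finset.univ.filter fun x => F x = c).filter S
            = (Finset.univ.filter fun x => G x = c).filter S := by
          ext x
          simp only [Finset.mem_filter, Finset.mem_univ, true_and]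
          constructor <;> rintro ⟨h1, h2⟩ <;> simp_all
        rw [← Finset.card_filter_add_card_filter_not S,
          ← Finset.card_filter_add_card_filter_not (s := Finset.univ.filter fun x => G x = c) S,
          hin, Nat.add_left_cancel_iff] at hFG
        rw [Nat.card_eq_fintype_card, Nat.card_eq_fintype_card, Fintype.card_subtype,
          Fintype.card_subtype]
        convert hFG using 2 <;>
        · ext x
          by_cases hx : S x <;> simp [hx])
  have hfix : ∀ k, S k → ρ k = k := fun k hk => by
    have := hρ k
    by_cases hk' : S (ρ k) <;> simp_all
  refine ⟨ρ, hfix, fun k => ?_⟩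
  by_cases hk : S k
  · rw [hfix k hk, hS k hk]
  · have := hρ k
    by_cases hk' : S (ρ k) <;> simp_all

lemma exists_restrict_perm (hmn : m ≤ n) (τ : Equiv.Perm (Fin n))
    (hτ : ∀ k : Fin m, (τ (Fin.castLE hmn k) : ℕ) < m) :
    ∃ τ' : Equiv.Perm (Fin m), ∀ k, Fin.castLE hmn (τ' k) = τ (Fin.castLE hmn k) := by
  refine ⟨Equiv.ofBijective (fun k => ⟨τ (Fin.castLE hmn k), hτ k⟩)
    (Finite.injective_iff_bijective.1 fun x y hxy => ?_), fun k => rfl⟩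
  exact Fin.castLE_injective hmn (τ.injective (Fin.ext (Fin.mk.inj hxy)))

end Permutations

section Rows

variable {n : ℕ} {lam : ℕ → ℕ}

lemma cumSum_mono (lam : ℕ → ℕ) : Monotone (cumSum lam) := fun _ _ h =>
  Finset.sum_le_sum_of_subset (Finset.range_mono h)

lemma rowOf_lt_iff {p N : ℕ} (hp : p < cumSum lam N) (r : ℕ) :
    rowOf lam p < r ↔ p < cumSum lam r := by
  have hne : {r | p < cumSum lam (r + 1)}.Nonempty :=
    ⟨N, hp.trans_le (cumSum_mono lam N.le_succ)⟩
  constructor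
  · intro h
    exact (Nat.sInf_mem hne).trans_le (cumSum_mono lam h)
  · intro h
    rcases r with _ | r
    · simp [cumSum] at h
    · exact Nat.lt_succ_of_le (Nat.sInf_le h)

lemma IsComposition.monotone_rowOf (h : IsComposition n lam) :
    Monotone fun p : Fin n => rowOf lam p := by
  obtain ⟨N, -, hN⟩ := h
  have key (p : Fin n) := rowOf_lt_iff (lam := lam) (N := N) (p.2.trans_eq hN.symm)
  intro p p' hpp'
  refine Nat.lt_succ_iff.1 ((key p _).2 ?_)
  exact (Fin.le_def.1 hpp').trans_lt ((key p' _).1 (Nat.lt_succ_self _))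

lemma IsComposition.cumSum_eq (h : IsComposition n lam) {L : ℕ} (hL : ∀ s, lam s = 0 ↔ L ≤ s) :
    cumSum lam L = n := by
  obtain ⟨N, hN, rfl⟩ := h
  refine Finset.sum_subset (Finset.range_mono ((hL N).1 (hN N le_rfl))) fun s _ hs => ?_
  exact (hL s).2 (by simpa using hs)

lemma cumSum_truncate_of_le {L r : ℕ} (hr : r + 1 ≤ L) :
    cumSum (fun s => if s + 1 < L then lam s else 0) r = cumSum lam r :=
  Finset.sum_congr rfl fun s hs => if_pos (by have := Finset.mem_range.1 hs; omega)

lemma rowOf_truncate {L p : ℕ} (hp : p < cumSum lam (L - 1)) :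
    rowOf (fun s => if s + 1 < L then lam s else 0) p = rowOf lam p := by
  have hL : 0 < L := by
    rcases L with _ | L
    · simp [cumSum] at hp
    · omega
  have hp' := hp
  rw [← cumSum_truncate_of_le (by omega : L - 1 + 1 ≤ L)] at hp'
  refine eq_of_forall_gt_iff fun r => ?_
  rw [rowOf_lt_iff hp, rowOf_lt_iff hp']
  rcases le_total r (L - 1) with h | h
  · rw [cumSum_truncate_of_le (by omega)]
  · exact ⟨fun _ => hp.trans_le (cumSum_mono _ h), fun _ => hp'.trans_le (cumSum_mono _ h)⟩

end Rows

section DoubleCosets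

variable {m n : ℕ} {lam lamt mu nu : ℕ → ℕ}

lemma mem_doubleCoset_iff {f : Fin n → ℕ} {d : Equiv.Perm (Fin n)}
    (hd : ∀ p, f (d p) = rowOf lam p) (w : Equiv.Perm (Fin n)) :
    w ∈ doubleCoset lam mu d ↔
      ∃ τ ∈ youngW (n := n) mu, ∀ p, f (τ (w p)) = rowOf lam p := by
  constructor
  · rintro ⟨u, hu, v, hv, rfl⟩
    refine ⟨v⁻¹, fun p => ?_, fun p => ?_⟩
    · simpa using (hv (v⁻¹ p)).symm
    · have := hu p
      rw [← hd] at this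
      simpa using this
  · rintro ⟨τ, hτ, h⟩
    refine ⟨d⁻¹ * τ * w, fun p => ?_, τ⁻¹, fun p => ?_, by group⟩
    · rw [← hd, ← h]
      simp
    · simpa using (hτ (τ⁻¹ p)).symm

/-- The minimal length representatives `e` of the cosets `e · S_m` (maps acting on the right) in
`S_n` such that the entries of `t^λ e` moved by `S_m` form a tableau with row lengths `λ̃`. -/
def shortReps (hmn : m ≤ n) (lam lamt : ℕ → ℕ) : Finset (Equiv.Perm (Fin n)) :=
  Finset.univ.filter fun e => StrictMono (fun k : Fin m => e⁻¹ (Fin.castLE hmn k)) ∧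
    ∀ k : Fin m, rowOf lam (e⁻¹ (Fin.castLE hmn k)) = rowOf lamt k

lemma embedPerm_mul_injective (hmn : m ≤ n) {e₁ e₂ : Equiv.Perm (Fin n)}
    {w₁ w₂ : Equiv.Perm (Fin m)}
    (h₁ : StrictMono fun k : Fin m => e₁⁻¹ (Fin.castLE hmn k))
    (h₂ : StrictMono fun k : Fin m => e₂⁻¹ (Fin.castLE hmn k))
    (h : embedPerm hmn w₁ * e₁ = embedPerm hmn w₂ * e₂) : e₁ = e₂ ∧ w₁ = w₂ := by
  have hw : w₁⁻¹ * w₂ = 1 := by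
    refine perm_eq_one_of_strictMono _ fun x y hxy => h₁.lt_iff_lt.1 ?_
    have he : e₁⁻¹ * embedPerm hmn (w₁⁻¹ * w₂) = e₂⁻¹ := by
      rw [map_mul, map_inv, eq_inv_iff_mul_eq_one, mul_assoc, mul_assoc, ← h]
      group
    have key (k : Fin m) : e₁⁻¹ (Fin.castLE hmn ((w₁⁻¹ * w₂) k)) = e₂⁻¹ (Fin.castLE hmn k) := by
      rw [← embedPerm_castLE, ← he, Equiv.Perm.mul_apply]
    simp only [key]
    exact h₂ hxy
  obtain rfl : w₁ = w₂ := inv_mul_eq_one.1 hw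
  exact ⟨mul_left_cancel h, rfl⟩

section

variable (hmn : m ≤ n) {f : Fin n → ℕ} {R : ℕ} {d : Equiv.Perm (Fin n)} {dt : Equiv.Perm (Fin m)}

lemma embedPerm_mul_mem_doubleCoset
    (hrow : ∀ k : Fin m, rowOf nu k = rowOf mu k)
    (hlast : ∀ k : Fin n, m ≤ k → rowOf mu k = R)
    (hd : ∀ p, f (d p) = rowOf lam p)
    (hdt : ∀ p, f (Fin.castLE hmn (dt p)) = rowOf lamt p)
    {e : Equiv.Perm (Fin n)} (he : e ∈ shortReps hmn lam lamt)
    {w : Equiv.Perm (Fin m)} (hw : w ∈ doubleCoset lamt nu dt) :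
    embedPerm hmn w * e ∈ doubleCoset lam mu d := by
  obtain ⟨-, he⟩ := (Finset.mem_filter.1 he).2
  obtain ⟨τ, hτ, hτw⟩ := (mem_doubleCoset_iff (f := fun k => f (Fin.castLE hmn k)) hdt w).1 hw
  obtain ⟨ρ, hρ, hρF⟩ := exists_perm_fixing (fun k : Fin n => (k : ℕ) < m)
    (fun k => f (embedPerm hmn (τ * w) k)) (fun k => rowOf lam (e⁻¹ k))
    ((embedPerm hmn (τ * w))⁻¹ * d * e⁻¹) (fun k => by simp [hd])
    (forall_fin_of_castLE hmn
      (fun k _ => by simp only [embedPerm_castLE, Equiv.Perm.mul_apply, hτw, he])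
      fun k hk hk' => absurd hk' (not_lt.2 hk))
  refine (mem_doubleCoset_iff hd _).2
    ⟨embedPerm hmn (τ * w) * ρ * embedPerm hmn w⁻¹, forall_fin_of_castLE hmn ?_ ?_, fun p => ?_⟩
  · intro k
    simp only [Equiv.Perm.mul_apply, embedPerm_castLE]
    rw [hρ _ (w⁻¹ k).2]
    simp [embedPerm_castLE, ← hrow]
    exact hτ k
  · intro k hk
    have hρk : m ≤ (ρ k : ℕ) := by
      by_contra! hlt
      have := ρ.injective (hρ _ hlt)
      omega
    simp only [Equiv.Perm.mul_apply]
    rw [embedPerm_of_le hmn _ k hk, embedPerm_of_le hmn _ _ hρk, hlast _ hk, hlast _ hρk]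
  · have := hρF (e p)
    simpa using this

lemma exists_embedPerm_mul_eq
    (hlam : IsComposition n lam) (hlamt : IsComposition m lamt)
    (hrow : ∀ k : Fin m, rowOf nu k = rowOf mu k)
    (hlast : ∀ k : Fin n, m ≤ k → rowOf mu k = R)
    (hne : ∀ k : Fin m, rowOf mu k ≠ R)
    (hd : ∀ p, f (d p) = rowOf lam p)
    (hdt : ∀ p, f (Fin.castLE hmn (dt p)) = rowOf lamt p)
    {w : Equiv.Perm (Fin n)} (hw : w ∈ doubleCoset lam mu d) :
    ∃ e ∈ shortReps hmn lam lamt, ∃ x ∈ doubleCoset lamt nu dt, embedPerm hmn x * e = w := by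
  obtain ⟨τ, hτ, hτw⟩ := (mem_doubleCoset_iff hd w).1 hw
  obtain ⟨τ', hτ'⟩ := exists_restrict_perm hmn τ fun k => by
    by_contra! hk
    exact hne k ((hτ (Fin.castLE hmn k)).symm.trans (hlast _ hk))
  set x := Tuple.sort fun k : Fin m => w⁻¹ (Fin.castLE hmn k) with hx
  have happ (k : Fin m) : ((embedPerm hmn x)⁻¹ * w)⁻¹ (Fin.castLE hmn k)
      = w⁻¹ (Fin.castLE hmn (x k)) := by
    simp [mul_inv_rev, embedPerm_castLE]
  have hmono : StrictMono fun k : Fin m => w⁻¹ (Fin.castLE hmn (x k)) :=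
    (Tuple.monotone_sort fun k : Fin m => w⁻¹ (Fin.castLE hmn k)).strictMono_of_injective
      fun a b hab => by simpa using hab
  have hval (k : Fin m) : rowOf lam (w⁻¹ (Fin.castLE hmn (x k)))
      = f (Fin.castLE hmn (τ' (x k))) := by
    rw [hτ', ← hτw]
    simp
  have heq (k : Fin m) : f (Fin.castLE hmn (τ' (x k))) = rowOf lamt k := by
    have := Tuple.unique_monotone (f := fun k : Fin m => f (Fin.castLE hmn k))
      (σ := τ' * x) (τ := dt)
      (fun a b hab => by
        simpa only [Function.comp_apply, Equiv.Perm.mul_apply, ← hval] using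
          hlam.monotone_rowOf (hmono.monotone hab))
      (fun a b hab => by simpa only [Function.comp_apply, hdt] using hlamt.monotone_rowOf hab)
    exact (congrFun this k).trans (hdt k)
  refine ⟨(embedPerm hmn x)⁻¹ * w, Finset.mem_filter.2 ⟨Finset.mem_univ _, ?_, fun k => ?_⟩, x,
    (mem_doubleCoset_iff (f := fun k => f (Fin.castLE hmn k)) hdt x).2 ⟨τ', fun k => ?_, heq⟩,
    mul_inv_cancel_left _ _⟩
  · simpa only [happ] using hmono
  · rw [happ, hval, heq]
  · rw [hrow, hrow]
    simpa [← hτ'] using hτ (Fin.castLE hmn k)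

end

end DoubleCosets

section Hecke

variable {F : Type*} [Field F] {H : Type*} [Ring H] [Algebra F H]
  {H' : Type*} [Ring H'] [Algebra F H'] {m n : ℕ} {q : F}
  {T : Equiv.Perm (Fin n) → H} {T' : Equiv.Perm (Fin m) → H'}

lemma IsHeckeBasis.mul_map_eq (hT : IsHeckeBasis q T) (hT' : IsHeckeBasis q T')
    (hmn : m ≤ n) (g : H' →ₐ[F] H)
    (hg : ∀ (i : ℕ) (hi : i + 1 < m), g (T' (adjT i hi)) = T (adjT i (hi.trans_le hmn)))
    {e : Equiv.Perm (Fin n)} (he : StrictMono fun k : Fin m => e⁻¹ (Fin.castLE hmn k))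
    (w : Equiv.Perm (Fin m)) :
    T e * g (T' w) = T (embedPerm hmn w * e) := by
  induction hl : permLength w using Nat.strong_induction_on generalizing w with
  | _ l ih =>
    by_cases hw : w = 1
    · simp [hw, hT'.one]
    obtain ⟨i, hi, hdesc⟩ := exists_inv_succ_lt_of_ne_one w hw
    obtain ⟨v, rfl⟩ : ∃ v, w = adjT i hi * v := ⟨(adjT i hi)⁻¹ * w, by simp⟩
    have hv : v⁻¹ ⟨i, Nat.lt_of_succ_lt hi⟩ < v⁻¹ ⟨i + 1, hi⟩ := by
      simpa [adjT, mul_inv_rev] using hdesc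
    have hlen := permLength_lt_adjT_mul v i hi hv
    rw [← hT'.mul_adj_asc v i hi hlen, map_mul, ← mul_assoc, ih _ (hl ▸ hlen) v rfl, hg,
      hT.mul_adj_asc, ← mul_assoc, ← embedPerm_adjT hmn, ← map_mul]
    refine permLength_lt_adjT_mul _ _ _ ?_
    have key (k : Fin m) : (embedPerm hmn v * e)⁻¹ (Fin.castLE hmn k)
        = e⁻¹ (Fin.castLE hmn (v⁻¹ k)) := by
      rw [mul_inv_rev, ← map_inv, Equiv.Perm.mul_apply, embedPerm_castLE]
    have := he hv
    simp only [← key] at this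
    exact this

end Hecke

/-- Proposition: `x_μ φ_A = h · Γ_0(x_{μ̃} φ_{Ã})`, bottom row.
`A` a row-standard `μ`-tableau of type `λ`; `L` the number of nonzero parts of `μ`;
`Ã` obtained by deleting the last row (row `L-1`, 0-indexed), a `μ̃`-tableau of type
`λ̃` over `H_{n-μ_l}`; `Γ_0 : H_{n-μ_l} → H_n` the standard embedding `T_i ↦ T_i`
(called `g` below).  There exists `h ∈ H_n`, depending only on `μ, λ, λ̃`, with
`x_μ φ_A = h * Γ_0(x_{μ̃} φ_{Ã})` for every such `A`. -/
theorem xphi_bottom_row_removal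
    {F : Type*} [Field F] {H : Type*} [Ring H] [Algebra F H]
    {H' : Type*} [Ring H'] [Algebra F H']
    {n : ℕ} (q : F) (hq : q ≠ 0)
    (mu lam lamt : ℕ → ℕ) (hmu : IsPartition n mu) (hlam : IsComposition n lam)
    (L : ℕ) (hLpos : 0 < L) (hL : ∀ s, mu s = 0 ↔ L ≤ s)
    (hlamt : IsComposition (n - mu (L-1)) lamt)
    (T : Equiv.Perm (Fin n) → H) (hT : IsHeckeBasis q T)
    (T' : Equiv.Perm (Fin (n - mu (L-1))) → H') (hT' : IsHeckeBasis q T')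
    (g : H' →ₐ[F] H)
    (hg : ∀ (i : ℕ) (hi : i + 1 < n - mu (L-1)),
      g (T' (adjT i hi)) = T (adjT i (by omega))) :
    ∃ h : H, ∀ (A : ℕ → Multiset ℕ) (d : Equiv.Perm (Fin n))
      (dt : Equiv.Perm (Fin (n - mu (L-1)))),
      RowsOfShape mu A → HasType A lam → Is1A mu lam A d →
      HasType (fun s => if s + 1 < L then A s else 0) lamt →
      Is1A (fun s => if s + 1 < L then mu s else 0) lamt
        (fun s => if s + 1 < L then A s else 0) dt →
      XPhi T lam mu d
        = h * g (XPhi T' lamt (fun s => if s + 1 < L then mu s else 0) dt) := by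
  have hmn : n - mu (L - 1) ≤ n := Nat.sub_le _ _
  have hsum : cumSum mu L = n := hmu.1.cumSum_eq hL
  have hm : cumSum mu (L - 1) = n - mu (L - 1) := by
    obtain ⟨L, rfl⟩ := Nat.exists_eq_succ_of_ne_zero hLpos.ne'
    rw [← hsum, cumSum, cumSum, Finset.sum_range_succ]
    simp
  have hrow_lt (k : Fin n) := rowOf_lt_iff (lam := mu) (N := L) (k.2.trans_eq hsum.symm)
  have hrow (k : Fin (n - mu (L - 1))) := rowOf_truncate (lam := mu) (L := L) (k.2.trans_eq hm.symm)
  have hlast (k : Fin n) (hk : n - mu (L - 1) ≤ k) : rowOf mu k = L - 1 := by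
    have h₁ := (hrow_lt k L).2 (k.2.trans_eq hsum.symm)
    have h₂ := mt (hrow_lt k (L - 1)).1 (by omega)
    omega
  have hlt (k : Fin (n - mu (L - 1))) : rowOf mu k < L - 1 :=
    (hrow_lt (Fin.castLE hmn k) _).2 (k.2.trans_eq hm.symm)
  refine ⟨∑ e ∈ shortReps hmn lam lamt, T e, fun A d dt _ _ hd _ hdt => ?_⟩
  set f : Fin n → ℕ := fun k => entryAt A (rowOf mu k) (k - cumSum mu (rowOf mu k)) with hf
  have hfd : ∀ p, f (d p) = rowOf lam p := hd.2
  have hfdt : ∀ p, f (Fin.castLE hmn (dt p)) = rowOf lamt p := fun p => by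
    rw [← hdt.2 p, hrow, cumSum_truncate_of_le (by have := hlt (dt p); omega)]
    simp only [hf, Fin.val_castLE, entryAt]
    rw [if_pos (by have := hlt (dt p); omega)]
  rw [XPhi, XPhi, map_sum, Finset.sum_mul_sum, ← Finset.sum_product']
  symm
  refine Finset.sum_bij (fun x _ => embedPerm hmn x.2 * x.1) ?_ ?_ ?_ ?_
  · rintro ⟨e, w⟩ h
    simp only [Finset.mem_product, Finset.mem_filter, Finset.mem_univ, true_and] at h ⊢
    exact embedPerm_mul_mem_doubleCoset hmn hrow hlast hfd hfdt h.1 h.2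
  · rintro ⟨e₁, w₁⟩ h₁ ⟨e₂, w₂⟩ h₂ h
    have h₁ := (Finset.mem_filter.1 (Finset.mem_product.1 h₁).1).2.1
    have h₂ := (Finset.mem_filter.1 (Finset.mem_product.1 h₂).1).2.1
    exact Prod.ext_iff.2 (embedPerm_mul_injective hmn h₁ h₂ h)
  · intro w hw
    obtain ⟨e, he, x, hx, rfl⟩ := exists_embedPerm_mul_eq hmn hlam hlamt hrow hlast
      (fun k => (hlt k).ne) hfd hfdt (Finset.mem_filter.1 hw).2
    exact ⟨(e, x), by simp [he, hx], rfl⟩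
  · rintro ⟨e, w⟩ h
    exact hT.mul_map_eq hT' hmn g hg (Finset.mem_filter.1 (Finset.mem_product.1 h).1).2.1 w

end FayersSemistd
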